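/- Let (G_n) be a sequence of finite simple graphs with uniformly bounded average degree (i.e., there is a constant C with 2|E(G_n)|/|V(G_n)| ≤ C for all n), with |V(G_n)| → ∞ and E(G_n)/|V(G_n)| → h as n → ∞ for some real h ≠ 0. Let (G_n') be a sequence of spanning subgraphs of (G_n) (same vertex set, edge set contained in that of G_n) such that the proportion |{v ∈ V(G_n') : deg_{G_n'}(v) = deg_{G_n}(v)}| / |V(G_n)| → 1 as n → ∞. Then E(G_n')/|V(G_n')| → h as n → ∞. -/

import Mathlib

open Real Filter SimpleGraph

/-- The adjacency matrix of a simple graph over `ℝ` is Hermitian (it is symmetric). -/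
lemma adjMatrix_isHermitian {V : Type*} [Fintype V] [DecidableEq V]
    (G : SimpleGraph V) [DecidableRel G.Adj] : (G.adjMatrix ℝ).IsHermitian := by
  unfold Matrix.IsHermitian
  rw [Matrix.conjTranspose_eq_transpose_of_trivial]
  exact G.isSymm_adjMatrix

/-- The eigenvalues (with multiplicity, indexed by the vertices) of the adjacency
matrix of a finite simple graph, regarded as a real symmetric matrix. -/
noncomputable def graphEigenvalues {V : Type*} [Fintype V] [DecidableEq V]
    (G : SimpleGraph V) : V → ℝ :=
  letI := Classical.decRel G.Adj
  (adjMatrix_isHermitian G).eigenvalues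

/-- The energy of a finite simple graph: the sum of the absolute values of the
eigenvalues (with multiplicity) of its adjacency matrix. -/
noncomputable def graphEnergy {V : Type*} [Fintype V] [DecidableEq V]
    (G : SimpleGraph V) : ℝ :=
  ∑ v, |graphEigenvalues G v|

open Matrix in
/-- The real spectral theorem: a symmetric matrix is diagonalized by an orthogonal matrix. -/
lemma Matrix.IsHermitian.exists_orthogonal_diagonalization {V : Type*} [Fintype V]
    [DecidableEq V] {M : Matrix V V ℝ} (hM : M.IsHermitian) :
    ∃ W : Matrix V V ℝ, W * Wᵀ = 1 ∧ Wᵀ * W = 1 ∧ M = W * diagonal hM.eigenvalues * Wᵀ := by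
  have h1 := Unitary.coe_mul_star_self hM.eigenvectorUnitary
  have h2 := Unitary.coe_star_mul_self hM.eigenvectorUnitary
  have h3 := hM.spectral_theorem
  rw [Unitary.conjStarAlgAut_apply] at h3
  rw [Unitary.coe_star] at h1
  rw [star_eq_conjTranspose, conjTranspose_eq_transpose_of_trivial] at h1 h2 h3
  exact ⟨hM.eigenvectorUnitary, h1, h2, h3⟩

open Finset Matrix in
/-- The diagonal of a symmetric matrix in any orthonormal basis has `ℓ¹` norm at most the sum of
the absolute values of the eigenvalues. -/
lemma Matrix.IsHermitian.sum_abs_diag_conj_le {V : Type*} [Fintype V] [DecidableEq V]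
    {M : Matrix V V ℝ} (hM : M.IsHermitian) {U : Matrix V V ℝ} (hU : U * Uᵀ = 1) :
    ∑ i, |(Uᵀ * M * U) i i| ≤ ∑ j, |hM.eigenvalues j| := by
  obtain ⟨W, -, hW, hMW⟩ := hM.exists_orthogonal_diagonalization
  generalize hM.eigenvalues = μ at hMW ⊢
  set Q := Uᵀ * W with hQ
  have hQQ : Qᵀ * Q = 1 := by
    calc Qᵀ * Q = Wᵀ * (U * Uᵀ) * W := by simp [hQ, Matrix.mul_assoc]
      _ = 1 := by rw [hU, Matrix.mul_one, hW]
  have hcol (j : V) : ∑ i, Q i j ^ 2 = 1 := by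
    have := congrFun (congrFun hQQ j) j
    simpa [Matrix.mul_apply, sq] using this
  have hconj : Uᵀ * M * U = Q * diagonal μ * Qᵀ := by
    rw [hMW, hQ]; simp [Matrix.mul_assoc]
  calc ∑ i, |(Uᵀ * M * U) i i| = ∑ i, |∑ j, Q i j ^ 2 * μ j| := by
        refine sum_congr rfl fun i _ => ?_
        rw [hconj, Matrix.mul_apply]
        congr 1
        refine sum_congr rfl fun j _ => ?_
        rw [mul_diagonal, transpose_apply]; ring
    _ ≤ ∑ i, ∑ j, Q i j ^ 2 * |μ j| := by
        refine sum_le_sum fun i _ => (abs_sum_le_sum_abs _ _).trans_eq ?_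
        simp [abs_mul]
    _ = ∑ j, |μ j| := by
        rw [sum_comm]
        simp [← sum_mul, hcol]

open Finset Matrix in
/-- The sum of the absolute values of the eigenvalues of a symmetric matrix is the `ℓ¹` norm of
its diagonal in a suitable orthonormal basis. -/
lemma Matrix.IsHermitian.exists_sum_abs_diag_conj_eq {V : Type*} [Fintype V] [DecidableEq V]
    {M : Matrix V V ℝ} (hM : M.IsHermitian) :
    ∃ U : Matrix V V ℝ, U * Uᵀ = 1 ∧
      ∑ j, |hM.eigenvalues j| = ∑ i, |(Uᵀ * M * U) i i| := by
  obtain ⟨U, h1, h2, h3⟩ := hM.exists_orthogonal_diagonalization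
  refine ⟨U, h1, ?_⟩
  generalize hM.eigenvalues = μ at h3 ⊢
  have : Uᵀ * M * U = diagonal μ := by
    calc Uᵀ * M * U = (Uᵀ * U) * diagonal μ * (Uᵀ * U) := by
          rw [h3]; simp [Matrix.mul_assoc]
      _ = diagonal μ := by rw [h2]; simp
  simp [this]

open Finset Matrix in
/-- The diagonal, in any orthonormal basis, of a matrix whose nonzero rows all lie in `B` has
`ℓ¹` norm at most the square root of `#B` times the squared Frobenius norm. -/
lemma Matrix.sum_abs_diag_conj_le_sqrt {V : Type*} [Fintype V] [DecidableEq V]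
    {U : Matrix V V ℝ} (hU : U * Uᵀ = 1) (D : Matrix V V ℝ) (B : Finset V)
    (hB : ∀ k ∉ B, ∀ l, D k l = 0) :
    ∑ i, |(Uᵀ * D * U) i i| ≤ √(#B * ∑ k, ∑ l, D k l ^ 2) := by
  have hrow (k : V) : ∑ i, U k i ^ 2 = 1 := by
    have := congrFun (congrFun hU k) k
    simpa [Matrix.mul_apply, sq] using this
  have hfrob (k : V) : ∑ i, (D * U) k i ^ 2 = ∑ l, D k l ^ 2 := by
    have : (D * U) * (D * U)ᵀ = D * Dᵀ := by
      calc (D * U) * (D * U)ᵀ = D * (U * Uᵀ) * Dᵀ := by simp [Matrix.mul_assoc]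
        _ = D * Dᵀ := by rw [hU, Matrix.mul_one]
    have := congrFun (congrFun this k) k
    rw [Matrix.mul_apply, Matrix.mul_apply] at this
    simpa only [transpose_apply, sq] using this
  have hzero (k : V) (hk : k ∉ B) (i : V) : (D * U) k i = 0 := by
    rw [Matrix.mul_apply]
    exact sum_eq_zero fun l _ => by rw [hB k hk l, zero_mul]
  calc ∑ i, |(Uᵀ * D * U) i i| = ∑ i, |∑ k ∈ B, U k i * (D * U) k i| := by
        refine sum_congr rfl fun i _ => ?_
        rw [Matrix.mul_assoc, Matrix.mul_apply]
        congr 1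
        refine (sum_subset (subset_univ B) fun k _ hk => ?_).symm
        rw [hzero k hk i, mul_zero]
    _ ≤ ∑ i, ∑ k ∈ B, |U k i| * |(D * U) k i| := by
        refine sum_le_sum fun i _ => (abs_sum_le_sum_abs _ _).trans_eq ?_
        simp only [abs_mul]
    _ = ∑ p ∈ univ ×ˢ B, |U p.2 p.1| * |(D * U) p.2 p.1| := by rw [sum_product]
    _ ≤ √(∑ p ∈ univ ×ˢ B, |U p.2 p.1| ^ 2) *
          √(∑ p ∈ univ ×ˢ B, |(D * U) p.2 p.1| ^ 2) := sum_mul_le_sqrt_mul_sqrt _ _ _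
    _ = √(#B * ∑ k ∈ B, ∑ l, D k l ^ 2) := by
        rw [← sqrt_mul (by positivity), sum_product_right, sum_product_right]
        simp [hrow, hfrob]
    _ ≤ √(#B * ∑ k, ∑ l, D k l ^ 2) := by
        gcongr
        exact subset_univ B

open Finset Matrix in
/-- Changing a symmetric matrix in the rows indexed by `B` changes the sum of the absolute values
of its eigenvalues by at most the square root of `#B` times the squared Frobenius norm of the
change. -/
lemma Matrix.IsHermitian.sum_abs_eigenvalues_le_add_sqrt {V : Type*} [Fintype V] [DecidableEq V]
    {M N : Matrix V V ℝ} (hM : M.IsHermitian) (hN : N.IsHermitian) (B : Finset V)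
    (hB : ∀ k ∉ B, ∀ l, M k l = N k l) :
    ∑ j, |hM.eigenvalues j| ≤
      ∑ j, |hN.eigenvalues j| + √(#B * ∑ k, ∑ l, (M k l - N k l) ^ 2) := by
  obtain ⟨U, hU, h⟩ := hM.exists_sum_abs_diag_conj_eq
  have hD := Matrix.sum_abs_diag_conj_le_sqrt hU (M - N) B
    fun k hk l => by rw [sub_apply, hB k hk l, sub_self]
  have hsplit : Uᵀ * M * U = Uᵀ * N * U + Uᵀ * (M - N) * U := by
    rw [← Matrix.add_mul, ← Matrix.mul_add, add_sub_cancel]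
  calc ∑ j, |hM.eigenvalues j| = ∑ i, |(Uᵀ * N * U) i i + (Uᵀ * (M - N) * U) i i| := by
        rw [h, hsplit]; rfl
    _ ≤ ∑ i, |(Uᵀ * N * U) i i| + ∑ i, |(Uᵀ * (M - N) * U) i i| := by
        rw [← sum_add_distrib]
        exact sum_le_sum fun i _ => abs_add_le _ _
    _ ≤ _ := add_le_add (hN.sum_abs_diag_conj_le hU) hD

lemma graphEnergy_eq_sum_abs_eigenvalues {V : Type*} [Fintype V] [DecidableEq V]
    (G : SimpleGraph V) [DecidableRel G.Adj] :
    graphEnergy G = ∑ v, |(adjMatrix_isHermitian G).eigenvalues v| := by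
  unfold graphEnergy graphEigenvalues
  congr!

open Finset in
/-- Deleting edges changes the energy of a graph by at most `√(b * 2m)`, where `b` is the number
of vertices whose degree changes and `m` is the number of edges of the original graph. -/
lemma abs_graphEnergy_sub_le {V : Type*} [Fintype V] [DecidableEq V]
    (G G' : SimpleGraph V) [DecidableRel G.Adj] [DecidableRel G'.Adj] (hle : G' ≤ G) :
    |graphEnergy G' - graphEnergy G| ≤
      √(#{v | ¬ G'.degree v = G.degree v} * (2 * #G.edgeFinset)) := by
  set B : Finset V := {v | ¬ G'.degree v = G.degree v} with hBdef
  have hB : ∀ k ∉ B, ∀ l, G'.adjMatrix ℝ k l = G.adjMatrix ℝ k l := by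
    intro k hk l
    have hdeg : G'.degree k = G.degree k := by simpa [hBdef] using hk
    have hsub : G'.neighborFinset k ⊆ G.neighborFinset k := fun x hx => by
      rw [mem_neighborFinset] at hx ⊢
      exact hle hx
    have heq : G'.neighborFinset k = G.neighborFinset k :=
      eq_of_subset_of_card_le hsub
        (by rw [card_neighborFinset_eq_degree, card_neighborFinset_eq_degree, hdeg])
    have hadj : G'.Adj k l ↔ G.Adj k l := by
      rw [← mem_neighborFinset, heq, mem_neighborFinset]
    simp [adjMatrix_apply, hadj]
  have hfrob : ∑ k, ∑ l, (G.adjMatrix ℝ k l - G'.adjMatrix ℝ k l) ^ 2 ≤ 2 * #G.edgeFinset := by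
    calc ∑ k, ∑ l, (G.adjMatrix ℝ k l - G'.adjMatrix ℝ k l) ^ 2
        ≤ ∑ k, ∑ l, G.adjMatrix ℝ k l := by
          refine sum_le_sum fun k _ => sum_le_sum fun l _ => ?_
          have := @hle k l
          by_cases h1 : G.Adj k l <;> by_cases h2 : G'.Adj k l <;>
            simp_all [adjMatrix_apply]
      _ = ((∑ k, G.degree k : ℕ) : ℝ) := by
          push_cast
          refine sum_congr rfl fun k _ => ?_
          simp [adjMatrix_apply, ← card_neighborFinset_eq_degree, neighborFinset_eq_filter]
      _ = 2 * #G.edgeFinset := by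
          rw [G.sum_degrees_eq_twice_card_edges]; push_cast; rfl
  have hsymm : ∑ k, ∑ l, (G'.adjMatrix ℝ k l - G.adjMatrix ℝ k l) ^ 2 =
      ∑ k, ∑ l, (G.adjMatrix ℝ k l - G'.adjMatrix ℝ k l) ^ 2 := by
    simp only [sub_sq_comm]
  have hsqrt : √(#B * ∑ k, ∑ l, (G.adjMatrix ℝ k l - G'.adjMatrix ℝ k l) ^ 2) ≤
      √(#B * (2 * #G.edgeFinset)) := by gcongr
  have h1 := (adjMatrix_isHermitian G).sum_abs_eigenvalues_le_add_sqrt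
    (adjMatrix_isHermitian G') B fun k hk l => (hB k hk l).symm
  have h2 := (adjMatrix_isHermitian G').sum_abs_eigenvalues_le_add_sqrt
    (adjMatrix_isHermitian G) B hB
  rw [hsymm] at h2
  rw [graphEnergy_eq_sum_abs_eigenvalues G, graphEnergy_eq_sum_abs_eigenvalues G', abs_le]
  constructor <;> linarith

/-- if `(G_n)` has uniformly bounded average degree, `|V(G_n)| → ∞`,
`E(G_n)/|V(G_n)| → h ≠ 0`, and `(G_n')` are spanning subgraphs of `(G_n)` such that
the proportion of vertices with the same degree in `G_n'` and `G_n` tends to `1`,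
then `E(G_n')/|V(G_n')| → h`. -/
theorem energy_per_vertex_spanning_subgraph {V : ℕ → Type*} [∀ n, Fintype (V n)]
    [∀ n, DecidableEq (V n)] (G G' : ∀ n, SimpleGraph (V n))
    [∀ n, DecidableRel (G n).Adj] [∀ n, DecidableRel (G' n).Adj]
    (C : ℝ) (hC : ∀ n, 2 * ((G n).edgeFinset.card : ℝ) ≤ C * (Fintype.card (V n) : ℝ))
    (hV : Tendsto (fun n => (Fintype.card (V n) : ℝ)) atTop atTop)
    (h : ℝ) (hh : h ≠ 0)
    (hE : Tendsto (fun n => graphEnergy (G n) / (Fintype.card (V n) : ℝ)) atTop (nhds h))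
    (hspan : ∀ n, G' n ≤ G n)
    (hdeg : Tendsto (fun n =>
        (((Finset.univ.filter fun v => (G' n).degree v = (G n).degree v).card : ℝ)) /
          (Fintype.card (V n) : ℝ)) atTop (nhds 1)) :
    Tendsto (fun n => graphEnergy (G' n) / (Fintype.card (V n) : ℝ)) atTop (nhds h) := by
  suffices hdiff : Tendsto (fun n => graphEnergy (G' n) / (Fintype.card (V n) : ℝ) -
      graphEnergy (G n) / (Fintype.card (V n) : ℝ)) atTop (nhds 0) by
    simpa using hdiff.add hE
  have hbound : Tendsto (fun n => √((1 -
      ((Finset.univ.filter fun v => (G' n).degree v = (G n).degree v).card : ℝ) /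
        (Fintype.card (V n) : ℝ)) * C)) atTop (nhds 0) := by
    simpa using ((hdeg.const_sub 1).mul_const C).sqrt
  refine squeeze_zero_norm' ?_ hbound
  filter_upwards [hV.eventually_gt_atTop 0] with n hn
  set N : ℝ := (Fintype.card (V n) : ℝ) with hN
  set g : ℝ := ((Finset.univ.filter fun v => (G' n).degree v = (G n).degree v).card : ℝ) with hg
  have hcard : ((Finset.univ.filter fun v => ¬ (G' n).degree v = (G n).degree v).card : ℝ) =
      N - g := by
    rw [eq_sub_iff_add_eq', hg, hN, ← Nat.cast_add, Finset.card_filter_add_card_filter_not,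
      Finset.card_univ]
  have hnonneg : 0 ≤ N - g := hcard ▸ Nat.cast_nonneg _
  rw [← sub_div, Real.norm_eq_abs, abs_div, abs_of_pos hn, div_le_iff₀ hn]
  calc |graphEnergy (G' n) - graphEnergy (G n)|
      ≤ √((N - g) * (2 * ((G n).edgeFinset.card : ℝ))) := by
        rw [← hcard]; exact abs_graphEnergy_sub_le _ _ (hspan n)
    _ ≤ √((N - g) * (C * N)) := Real.sqrt_le_sqrt (mul_le_mul_of_nonneg_left (hC n) hnonneg)
    _ = √((1 - g / N) * C * N ^ 2) := by congr 1; field_simp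
    _ = √((1 - g / N) * C) * N := by rw [Real.sqrt_mul' _ (sq_nonneg N), Real.sqrt_sq hn.le]
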